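/- Let G be a finite simple graph of order n and let s, t be integers with 1 ≤ s < t < ω(G). Then ((t+1)·k_{t+1}(G))/(t·k_t(G)) − n/t ≥ ((s+1)·k_{s+1}(G))/(s·k_s(G)) − n/s. (Note that k_s(G), k_t(G) > 0 since s, t < ω(G).) -/

import Mathlib

open Finset

/-- The number of `k`-walks in `G`: sequences `v₁, …, v_k` of vertices of `G` such that
consecutive vertices are adjacent. -/
noncomputable def walkCount {V : Type*} [Fintype V] (G : SimpleGraph V) (k : ℕ) : ℕ :=
  Nat.card {f : Fin k → V //
    ∀ (i : ℕ) (h : i + 1 < k), G.Adj (f ⟨i, Nat.lt_of_succ_lt h⟩) (f ⟨i + 1, h⟩)}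

/-- The number of `k`-walks in `G` starting at the vertex `u`. -/
noncomputable def walkCountFrom {V : Type*} [Fintype V] (G : SimpleGraph V) (u : V) (k : ℕ) : ℕ :=
  Nat.card {f : Fin k → V //
    (∀ (h : 0 < k), f ⟨0, h⟩ = u) ∧
    ∀ (i : ℕ) (h : i + 1 < k), G.Adj (f ⟨i, Nat.lt_of_succ_lt h⟩) (f ⟨i + 1, h⟩)}

/-- The number of `s`-cliques of `G`. -/
def cliqueCount {V : Type*} [Fintype V] [DecidableEq V] (G : SimpleGraph V) [DecidableRel G.Adj]
    (s : ℕ) : ℕ :=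
  (G.cliqueFinset s).card

/-- The number of `s`-cliques of `G` containing the vertex `u`. -/
def cliqueCountOn {V : Type*} [Fintype V] [DecidableEq V] (G : SimpleGraph V) [DecidableRel G.Adj]
    (u : V) (s : ℕ) : ℕ :=
  ((G.cliqueFinset s).filter (fun t => u ∈ t)).card

lemma adjMatrix_isHermitian {V : Type*} [Fintype V] [DecidableEq V] (G : SimpleGraph V)
    [DecidableRel G.Adj] : (G.adjMatrix ℝ).IsHermitian := by
  rw [Matrix.IsHermitian, Matrix.conjTranspose_eq_transpose_of_trivial]
  exact SimpleGraph.isSymm_adjMatrix G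

/-- The largest eigenvalue (spectral radius) of the adjacency matrix of `G`. -/
noncomputable def adjSpectralRadius {V : Type*} [Fintype V] [DecidableEq V] (G : SimpleGraph V)
    [DecidableRel G.Adj] : ℝ :=
  ⨆ i, (adjMatrix_isHermitian G).eigenvalues i

/-- Common neighbourhood of a vertex set. -/
def mmExt {V : Type*} [Fintype V] [DecidableEq V] (G : SimpleGraph V) [DecidableRel G.Adj]
    (A : Finset V) : Finset V := univ.filter (fun w => ∀ a ∈ A, G.Adj w a)

lemma mm_double {V : Type*} [Fintype V] [DecidableEq V] (G : SimpleGraph V) [DecidableRel G.Adj]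
    (m : ℕ) (f : Finset V → ℕ) :
    ∑ A ∈ G.cliqueFinset m, #(mmExt G A) * f A
      = ∑ C ∈ G.cliqueFinset (m + 1), ∑ v ∈ C, f (C.erase v) := by
  have h1 : ∀ A ∈ G.cliqueFinset m, #(mmExt G A) * f A = ∑ w ∈ mmExt G A, f A := by
    intro A _
    simp
  rw [Finset.sum_congr rfl h1, Finset.sum_sigma', Finset.sum_sigma']
  have key : ∀ (A : Finset V) (w : V), w ∈ mmExt G A → w ∉ A := by
    intro A w hw hA
    simp only [mmExt, mem_filter, mem_univ, true_and] at hw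
    exact G.loopless.irrefl w (hw w hA)
  refine Finset.sum_bij' (fun p _ => ⟨insert p.2 p.1, p.2⟩) (fun q _ => ⟨q.1.erase q.2, q.2⟩)
    ?_ ?_ ?_ ?_ ?_
  · rintro ⟨A, w⟩ h
    simp only [mem_sigma, SimpleGraph.mem_cliqueFinset_iff] at h ⊢
    refine ⟨h.1.insert ?_, mem_insert_self _ _⟩
    have := h.2
    simpa [mmExt] using this
  · rintro ⟨C, v⟩ h
    simp only [mem_sigma, SimpleGraph.mem_cliqueFinset_iff] at h ⊢
    refine ⟨by simpa using h.1.erase_of_mem h.2, ?_⟩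
    simp only [mmExt, mem_filter, mem_univ, true_and, mem_erase]
    rintro a ⟨ha, haC⟩
    exact h.1.isClique h.2 haC (Ne.symm ha)
  · rintro ⟨A, w⟩ h
    simp only [mem_sigma] at h
    simp [erase_insert (key _ _ h.2)]
  · rintro ⟨C, v⟩ h
    simp only [mem_sigma] at h
    simp [insert_erase h.2]
  · rintro ⟨A, w⟩ h
    simp only [mem_sigma] at h
    simp [erase_insert (key _ _ h.2)]

lemma mm_count {V : Type*} [Fintype V] [DecidableEq V] (G : SimpleGraph V) [DecidableRel G.Adj]
    (m : ℕ) : ∑ A ∈ G.cliqueFinset m, #(mmExt G A) = (m + 1) * cliqueCount G (m + 1) := by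
  have h := mm_double G m (fun _ => 1)
  simp only [mul_one] at h
  rw [h]
  have : ∀ C ∈ G.cliqueFinset (m + 1), ∑ v ∈ C, 1 = m + 1 := by
    intro C hC
    rw [SimpleGraph.mem_cliqueFinset_iff] at hC
    simp [hC.card_eq]
  rw [Finset.sum_congr rfl this]
  simp [cliqueCount, mul_comm]

lemma mm_local {V : Type*} [Fintype V] [DecidableEq V] (G : SimpleGraph V) [DecidableRel G.Adj]
    (m : ℕ) (C : Finset V) (hC : #C = m + 1) :
    ∑ v ∈ C, #(mmExt G (C.erase v)) ≤ Fintype.card V + m * #(mmExt G C) := by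
  have h1 : ∑ v ∈ C, #(mmExt G (C.erase v))
      = ∑ w : V, #(C.filter (fun v => w ∈ mmExt G (C.erase v))) := by
    have := Finset.sum_card_bipartiteAbove_eq_sum_card_bipartiteBelow
      (s := C) (t := (univ : Finset V)) (fun v w => w ∈ mmExt G (C.erase v))
    simpa [Finset.bipartiteAbove, Finset.bipartiteBelow] using this
  have h2 : Fintype.card V + m * #(mmExt G C)
      = ∑ w : V, (1 + if w ∈ mmExt G C then m else 0) := by
    rw [Finset.sum_add_distrib]
    simp [mul_comm]
  rw [h1, h2]
  refine Finset.sum_le_sum fun w _ => ?_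
  split_ifs with hw
  · calc _ ≤ #C := card_filter_le _ _
      _ = 1 + m := by omega
  · rw [add_zero, Finset.card_le_one]
    intro a ha b hb
    by_contra hab
    apply hw
    simp only [mmExt, mem_filter, mem_univ, true_and, mem_erase] at ha hb ⊢
    intro c hc
    by_cases hca : c = a
    · exact hb.2 c ⟨by rw [hca]; exact hab, hc⟩
    · exact ha.2 c ⟨hca, hc⟩

lemma mm_step {V : Type*} [Fintype V] [DecidableEq V] (G : SimpleGraph V) [DecidableRel G.Adj]
    (m : ℕ) : ((m + 1) * cliqueCount G (m + 1)) ^ 2 ≤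
      cliqueCount G m * (Fintype.card V * cliqueCount G (m + 1)
        + m * ((m + 2) * cliqueCount G (m + 2))) := by
  rw [← mm_count G m]
  refine (sq_sum_le_card_mul_sum_sq).trans ?_
  refine Nat.mul_le_mul_left _ ?_
  simp only [sq]
  rw [mm_double G m (fun A => #(mmExt G A))]
  calc _ ≤ ∑ C ∈ G.cliqueFinset (m + 1), (Fintype.card V + m * #(mmExt G C)) := by
        refine Finset.sum_le_sum fun C hC => ?_
        rw [SimpleGraph.mem_cliqueFinset_iff] at hC
        exact mm_local G m C hC.card_eq
    _ = _ := by
        rw [Finset.sum_add_distrib, ← Finset.mul_sum, mm_count G (m + 1)]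
        simp [cliqueCount, mul_comm]

lemma mm_pos {V : Type*} [Fintype V] [DecidableEq V] (G : SimpleGraph V) [DecidableRel G.Adj]
    (m : ℕ) (hm : m ≤ G.cliqueNum) : 0 < cliqueCount G m := by
  obtain ⟨S, hS⟩ := G.exists_isNClique_cliqueNum
  obtain ⟨T, hT, hc⟩ := Finset.exists_subset_card_eq (hm.trans hS.card_eq.ge)
  refine Finset.card_pos.2 ⟨T, ?_⟩
  rw [SimpleGraph.mem_cliqueFinset_iff]
  exact ⟨hS.isClique.subset (by exact_mod_cast hT), hc⟩

lemma mm_step_real {V : Type*} [Fintype V] [DecidableEq V] (G : SimpleGraph V)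
    [DecidableRel G.Adj] (m : ℕ) (h1 : 1 ≤ m) (hm : m + 1 ≤ G.cliqueNum) :
    ((m : ℝ) + 1) * cliqueCount G (m + 1) / ((m : ℝ) * cliqueCount G m)
        - (Fintype.card V : ℝ) / m ≤
      (((m + 1 : ℕ) : ℝ) + 1) * cliqueCount G (m + 1 + 1)
        / (((m + 1 : ℕ) : ℝ) * cliqueCount G (m + 1)) - (Fintype.card V : ℝ) / ((m + 1 : ℕ) : ℝ) := by
  have ha : (0 : ℝ) < cliqueCount G m := by exact_mod_cast mm_pos G m (by omega)
  have hb : (0 : ℝ) < cliqueCount G (m + 1) := by exact_mod_cast mm_pos G (m + 1) hm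
  have hm0 : (0 : ℝ) < m := by exact_mod_cast h1
  have h : (((m : ℝ) + 1) * cliqueCount G (m + 1)) ^ 2 ≤
      cliqueCount G m * (Fintype.card V * cliqueCount G (m + 1)
        + m * ((m + 2) * cliqueCount G (m + 1 + 1))) := by exact_mod_cast mm_step G m
  push_cast
  generalize (cliqueCount G m : ℝ) = a at *
  generalize (cliqueCount G (m + 1) : ℝ) = b at *
  generalize (cliqueCount G (m + 1 + 1) : ℝ) = c at *
  generalize (Fintype.card V : ℝ) = n at *
  generalize (m : ℝ) = x at *
  rw [← sub_nonneg]
  have : (x + 1 + 1) * c / ((x + 1) * b) - n / (x + 1) - ((x + 1) * b / (x * a) - n / x)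
      = (a * (n * b + x * ((x + 2) * c)) - ((x + 1) * b) ^ 2) / (x * (x + 1) * a * b) := by
    field_simp
    ring
  rw [this]
  exact div_nonneg (by linarith) (by positivity)

/-- **Moon–Moser.** For a graph `G` of order `n` and integers `1 ≤ s < t < ω(G)`,
`((t+1)·k_{t+1}(G))/(t·k_t(G)) − n/t ≥ ((s+1)·k_{s+1}(G))/(s·k_s(G)) − n/s`. -/
theorem moon_moser_ineq {V : Type*} [Fintype V] [DecidableEq V]
    (G : SimpleGraph V) [DecidableRel G.Adj] (s t : ℕ)
    (hs1 : 1 ≤ s) (hst : s < t) (htω : t < G.cliqueNum)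
    (n : ℕ) (hn : n = Fintype.card V) :
    ((t : ℝ) + 1) * cliqueCount G (t + 1) / ((t : ℝ) * cliqueCount G t) - (n : ℝ) / t ≥
      ((s : ℝ) + 1) * cliqueCount G (s + 1) / ((s : ℝ) * cliqueCount G s) - (n : ℝ) / s := by
  subst hn
  induction t, hst using Nat.le_induction with
  | base => exact mm_step_real G s hs1 (by omega)
  | succ k hk ih =>
    have hk' : s + 1 ≤ k := hk
    exact (ih (by omega)).le.trans (mm_step_real G k (by omega) (by omega))
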